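/- Let n ≥ 1, ε > 0, and let a : ℝⁿ → Mₙ(ℝ) be a measurable matrix-valued function satisfying ε·Iₙ ≤ a(x) ≤ ε⁻¹·Iₙ for all x ∈ ℝⁿ. If f : ℝⁿ → ℝ is a bounded C¹ function that is a global weak solution of ∂_j(a^{ij}(x) ∂_i f(x)) = 0, i.e. ∫_{ℝⁿ} ⟨a(x)·∇f(x), ∇φ(x)⟩ dx = 0 for every smooth compactly supported φ : ℝⁿ → ℝ, then f is constant. -/

import Mathlib

open Matrix MeasureTheory Metric Real

noncomputable section

/-- `ℝⁿ` with the Euclidean structure. -/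
abbrev En (n : ℕ) := EuclideanSpace ℝ (Fin n)

/-- The partial derivative `∂ᵢ f (x)`. -/
def pdrv (n : ℕ) (i : Fin n) (f : En n → ℝ) (x : En n) : ℝ :=
  fderiv ℝ f x (EuclideanSpace.single i 1)

/-- The gradient `∇f(x)` as a vector in `Fin n → ℝ`. -/
def gradv (n : ℕ) (f : En n → ℝ) (x : En n) : Fin n → ℝ := fun i => pdrv n i f x

/-- The coordinate vector of a continuous linear functional. -/
def cvec {n : ℕ} (l : En n →L[ℝ] ℝ) : Fin n → ℝ := fun i => l (EuclideanSpace.single i 1)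

/-- The bilinear form of a matrix on the dual space. -/
def bf {n : ℕ} (A : Matrix (Fin n) (Fin n) ℝ) (l m : En n →L[ℝ] ℝ) : ℝ :=
  (A *ᵥ cvec l) ⬝ᵥ cvec m

/-- Uniform ellipticity. -/
structure Ell (n : ℕ) (ε : ℝ) (a : En n → Matrix (Fin n) (Fin n) ℝ) : Prop where
  eps : 0 < ε
  meas : ∀ i j, Measurable fun x => a x i j
  ell : ∀ x, (a x - ε • (1 : Matrix (Fin n) (Fin n) ℝ)).PosSemidef ∧
      ((ε⁻¹ : ℝ) • (1 : Matrix (Fin n) (Fin n) ℝ) - a x).PosSemidef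

/-- Weak solutions. -/
def Weak (n : ℕ) (a : En n → Matrix (Fin n) (Fin n) ℝ) (f : En n → ℝ) : Prop :=
  ∀ φ : En n → ℝ, ContDiff ℝ (⊤ : ℕ∞) φ → HasCompactSupport φ →
      ∫ x, bf (a x) (fderiv ℝ f x) (fderiv ℝ φ x) = 0

section algebra
variable {n : ℕ} (A : Matrix (Fin n) (Fin n) ℝ) (l l' m m' : En n →L[ℝ] ℝ) (c : ℝ)

lemma cvec_add : cvec (l + m) = cvec l + cvec m := rfl
lemma cvec_smul : cvec (c • l) = c • cvec l := rfl

lemma bf_add_left : bf A (l + l') m = bf A l m + bf A l' m := by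
  simp [bf, cvec_add, Matrix.mulVec_add, add_dotProduct]
lemma bf_add_right : bf A l (m + m') = bf A l m + bf A l m' := by
  simp [bf, cvec_add, dotProduct_add]
lemma bf_smul_left : bf A (c • l) m = c * bf A l m := by
  simp [bf, cvec_smul, Matrix.mulVec_smul, smul_dotProduct]
lemma bf_smul_right : bf A l (c • m) = c * bf A l m := by
  simp [bf, cvec_smul, dotProduct_smul]

lemma norm_le_cvec : ‖l‖ ^ 2 ≤ cvec l ⬝ᵥ cvec l := by
  have h1 : ‖l‖ ≤ √(cvec l ⬝ᵥ cvec l) := by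
    refine ContinuousLinearMap.opNorm_le_bound _ (Real.sqrt_nonneg _) fun x => ?_
    have hx : l x = ∑ i, x i * cvec l i := by
      conv_lhs => rw [← (EuclideanSpace.basisFun (Fin n) ℝ).sum_repr x]
      simp [cvec]
    rw [hx, Real.norm_eq_abs, EuclideanSpace.norm_eq, ← Real.sqrt_mul (by
      exact Finset.sum_nonneg fun i _ => mul_self_nonneg _)]
    apply Real.abs_le_sqrt
    have := Finset.sum_mul_sq_le_sq_mul_sq Finset.univ (fun i => x i) (cvec l)
    refine this.trans (le_of_eq ?_)
    rw [mul_comm]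
    simp [dotProduct, sq]
  calc ‖l‖ ^ 2 ≤ (√(cvec l ⬝ᵥ cvec l)) ^ 2 := by gcongr
    _ = _ := Real.sq_sqrt (by exact Finset.sum_nonneg fun i _ => mul_self_nonneg _)

lemma cvec_abs_le (i : Fin n) : |cvec l i| ≤ ‖l‖ := by
  have := l.le_opNorm (EuclideanSpace.single i 1)
  simpa [cvec] using this

lemma cvec_le_norm : cvec l ⬝ᵥ cvec l ≤ n * ‖l‖ ^ 2 := by
  have : ∀ i ∈ Finset.univ, cvec l i * cvec l i ≤ ‖l‖ ^ 2 := fun i _ => by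
    have := cvec_abs_le l i
    nlinarith [abs_nonneg (cvec l i), abs_mul_abs_self (cvec l i)]
  simpa [dotProduct] using Finset.sum_le_card_nsmul _ _ _ this

end algebra

lemma bf_eq_sum {n : ℕ} (A : Matrix (Fin n) (Fin n) ℝ) (l m : En n →L[ℝ] ℝ) :
    bf A l m = ∑ i, ∑ j, A i j * (cvec l j * cvec m i) := by
  simp [bf, dotProduct, Matrix.mulVec, Finset.sum_mul, mul_assoc]

namespace Ell
variable {n : ℕ} {ε : ℝ} {a : En n → Matrix (Fin n) (Fin n) ℝ}

lemma symm (h : Ell n ε a) (x : En n) : (a x)ᵀ = a x := by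
  have h1 := (h.ell x).1.isHermitian
  have h2 : (a x - ε • (1 : Matrix (Fin n) (Fin n) ℝ))ᵀ = a x - ε • 1 := by
    simpa [Matrix.IsHermitian, Matrix.conjTranspose_eq_transpose_of_trivial] using h1
  simpa using h2

lemma bf_symm (h : Ell n ε a) (x : En n) (l m : En n →L[ℝ] ℝ) : bf (a x) l m = bf (a x) m l := by
  unfold bf
  rw [dotProduct_comm, Matrix.dotProduct_mulVec, ← Matrix.mulVec_transpose, h.symm]

lemma lower' (h : Ell n ε a) (x : En n) (l : En n →L[ℝ] ℝ) : ε * (cvec l ⬝ᵥ cvec l) ≤ bf (a x) l l := by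
  have := (h.ell x).1.dotProduct_mulVec_nonneg (cvec l)
  simp [Matrix.sub_mulVec, Matrix.smul_mulVec, dotProduct_sub] at this
  rw [bf, dotProduct_comm (a x *ᵥ cvec l)]; exact this

lemma upper' (h : Ell n ε a) (x : En n) (l : En n →L[ℝ] ℝ) : bf (a x) l l ≤ ε⁻¹ * (cvec l ⬝ᵥ cvec l) := by
  have := (h.ell x).2.dotProduct_mulVec_nonneg (cvec l)
  simp [Matrix.sub_mulVec, Matrix.smul_mulVec, dotProduct_sub] at this
  rw [bf, dotProduct_comm (a x *ᵥ cvec l)]; exact this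

lemma lower (h : Ell n ε a) (x : En n) (l : En n →L[ℝ] ℝ) : ε * ‖l‖ ^ 2 ≤ bf (a x) l l :=
  (mul_le_mul_of_nonneg_left (norm_le_cvec l) h.eps.le).trans (h.lower' x l)

lemma upper (h : Ell n ε a) (x : En n) (l : En n →L[ℝ] ℝ) : bf (a x) l l ≤ ε⁻¹ * n * ‖l‖ ^ 2 := by
  refine (h.upper' x l).trans ?_
  rw [mul_assoc]
  exact mul_le_mul_of_nonneg_left (cvec_le_norm l) (inv_nonneg.2 h.eps.le)

lemma nonneg (h : Ell n ε a) (x : En n) (l : En n →L[ℝ] ℝ) : 0 ≤ bf (a x) l l :=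
  le_trans (mul_nonneg h.eps.le (sq_nonneg _)) (h.lower x l)

lemma cs (h : Ell n ε a) (x : En n) (l m : En n →L[ℝ] ℝ) (t K : ℝ) (ht : 0 ≤ t) (hK : 0 ≤ K)
    (hm : bf (a x) m m ≤ t * K) : - bf (a x) l m ≤ (t * bf (a x) l l + K) / 2 := by
  rcases ht.eq_or_lt with rfl | ht
  · have h1 := h.lower x m
    have h2 : ‖m‖ ^ 2 ≤ 0 := by
      have := h.eps
      by_contra hc
      push Not at hc
      nlinarith [mul_pos this hc]
    have h3 : m = 0 := by
      have : ‖m‖ = 0 := by nlinarith [norm_nonneg m]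
      simpa using this
    subst h3
    have : bf (a x) l 0 = 0 := by simpa using bf_smul_right (a x) l 0 0
    rw [this]; linarith
  · have h1 := h.nonneg x (t • l + m)
    rw [bf_add_left, bf_add_right, bf_add_right, bf_smul_left, bf_smul_left, bf_smul_right,
      bf_smul_right, h.bf_symm x m l] at h1
    have : 0 ≤ t * (t * bf (a x) l l + 2 * bf (a x) l m + K) := by nlinarith
    have := nonneg_of_mul_nonneg_right this ht
    linarith

/-- entries are bounded -/
lemma entry (h : Ell n ε a) (x : En n) (i j : Fin n) : |a x i j| ≤ ε⁻¹ := by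
  have key : ∀ v : Fin n → ℝ, 0 ≤ v ⬝ᵥ (a x *ᵥ v) ∧ v ⬝ᵥ (a x *ᵥ v) ≤ ε⁻¹ * (v ⬝ᵥ v) := by
    intro v
    have h1 := (h.ell x).1.dotProduct_mulVec_nonneg v
    have h2 := (h.ell x).2.dotProduct_mulVec_nonneg v
    simp [Matrix.sub_mulVec, Matrix.smul_mulVec, dotProduct_sub] at h1 h2
    refine ⟨le_trans (mul_nonneg h.eps.le ?_) h1, h2⟩
    exact Finset.sum_nonneg fun i _ => mul_self_nonneg _
  have e : ∀ i j, Pi.single i (1:ℝ) ⬝ᵥ (a x *ᵥ Pi.single j 1) = a x i j := by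
    intro i j; simp
  have hs : a x j i = a x i j := by
    conv_lhs => rw [← h.symm x]
    rfl
  have f1 := key (Pi.single i 1 + Pi.single j 1)
  have f2 := key (Pi.single i 1 - Pi.single j 1)
  have f3 : (Pi.single i (1:ℝ) + Pi.single j 1 : Fin n → ℝ) ⬝ᵥ (Pi.single i 1 + Pi.single j 1) +
    (Pi.single i (1:ℝ) - Pi.single j 1 : Fin n → ℝ) ⬝ᵥ (Pi.single i 1 - Pi.single j 1) = 4 := by
    simp only [dotProduct_add, add_dotProduct, dotProduct_sub, sub_dotProduct, dotProduct_single]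
    simp
    ring
  have f4 : (Pi.single i (1:ℝ) + Pi.single j 1 : Fin n → ℝ) ⬝ᵥ (a x *ᵥ (Pi.single i 1 + Pi.single j 1)) -
    (Pi.single i (1:ℝ) - Pi.single j 1 : Fin n → ℝ) ⬝ᵥ (a x *ᵥ (Pi.single i 1 - Pi.single j 1))
      = 4 * a x i j := by
    simp only [dotProduct_add, add_dotProduct, dotProduct_sub, sub_dotProduct, Matrix.mulVec_add,
      Matrix.mulVec_sub, e, hs]
    ring
  have h0 : 0 ≤ ε⁻¹ := inv_nonneg.2 h.eps.le
  rw [abs_le]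
  have f5 : ε⁻¹ * ((Pi.single i (1:ℝ) + Pi.single j 1 : Fin n → ℝ) ⬝ᵥ (Pi.single i 1 + Pi.single j 1)) +
    ε⁻¹ * ((Pi.single i (1:ℝ) - Pi.single j 1 : Fin n → ℝ) ⬝ᵥ (Pi.single i 1 - Pi.single j 1)) = ε⁻¹ * 4 := by
    rw [← mul_add, f3]
  constructor <;> linarith [f1.1, f1.2, f2.1, f2.2]

lemma bf_meas (h : Ell n ε a) {u v : En n → (En n →L[ℝ] ℝ)} (hu : Continuous u) (hv : Continuous v) :
    Measurable fun x => bf (a x) (u x) (v x) := by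
  simp only [bf_eq_sum]
  refine Finset.measurable_sum _ fun i _ => Finset.measurable_sum _ fun j _ => ?_
  refine (h.meas i j).mul ?_
  have : Continuous fun x => cvec (u x) j * cvec (v x) i := by unfold cvec; fun_prop
  exact this.measurable

lemma bf_int (h : Ell n ε a) {u v : En n → (En n →L[ℝ] ℝ)} (hu : Continuous u) (hv : Continuous v)
    (hc : HasCompactSupport v) : Integrable fun x => bf (a x) (u x) (v x) := by
  simp only [bf_eq_sum]
  refine integrable_finsetSum _ fun i _ => integrable_finsetSum _ fun j _ => ?_
  have c1 : Continuous fun x => cvec (u x) j * cvec (v x) i := by unfold cvec; fun_prop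
  have c2 : HasCompactSupport fun x => cvec (u x) j * cvec (v x) i := by
    have : HasCompactSupport fun x => cvec (v x) i :=
      hc.comp_left (g := fun l => cvec l i) (by simp [cvec])
    exact this.mul_left
  refine (c1.integrable_of_hasCompactSupport c2).bdd_mul (c := ε⁻¹) (h.meas i j).aestronglyMeasurable ?_
  exact Filter.Eventually.of_forall fun x => h.entry x i j

lemma bf_abs (h : Ell n ε a) (x : En n) (l m : En n →L[ℝ] ℝ) : |bf (a x) l m| ≤ n * n * ε⁻¹ * (‖l‖ * ‖m‖) := by
  rw [bf_eq_sum]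
  have h0 : 0 ≤ ε⁻¹ := inv_nonneg.2 h.eps.le
  calc _ ≤ ∑ i, |∑ j, a x i j * (cvec l j * cvec m i)| := Finset.abs_sum_le_sum_abs _ _
    _ ≤ ∑ i, ∑ j, |a x i j * (cvec l j * cvec m i)| :=
        Finset.sum_le_sum fun i _ => Finset.abs_sum_le_sum_abs _ _
    _ ≤ ∑ i : Fin n, ∑ j : Fin n, ε⁻¹ * (‖l‖ * ‖m‖) := by
        refine Finset.sum_le_sum fun i _ => Finset.sum_le_sum fun j _ => ?_
        rw [abs_mul, abs_mul]
        have := h.entry x i j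
        have := cvec_abs_le l j
        have := cvec_abs_le m i
        gcongr
    _ = _ := by simp; ring
end Ell

namespace Ell
variable {n : ℕ} {ε : ℝ} {a : En n → Matrix (Fin n) (Fin n) ℝ}

lemma bf_cont_right (A : Matrix (Fin n) (Fin n) ℝ) (l : En n →L[ℝ] ℝ) :
    Continuous fun m => bf A l m := by
  simp only [bf_eq_sum]
  unfold cvec
  fun_prop

open Filter Topology in
lemma weak_C1 (h : Ell n ε a) {f : En n → ℝ} (hf : ContDiff ℝ 1 f) (hw : Weak n a f)
    {φ : En n → ℝ} (hφ : ContDiff ℝ 1 φ) (hc : HasCompactSupport φ) :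
    ∫ x, bf (a x) (fderiv ℝ f x) (fderiv ℝ φ x) = 0 := by
  have hδ : ∀ i : ℕ, (0:ℝ) < 1 / ((i:ℝ) + 1) := fun i => Nat.one_div_pos_of_nat
  let ρ : ℕ → ContDiffBump (0 : En n) := fun i =>
    ⟨(1 / ((i:ℝ) + 1)) / 2, 1 / ((i:ℝ) + 1), half_pos (hδ i), half_lt_self (hδ i)⟩
  have hρ : Tendsto (fun i => (ρ i).rOut) atTop (𝓝 0) := tendsto_one_div_add_atTop_nhds_zero_nat
  have hρ1 : ∀ i, (ρ i).rOut ≤ 1 := fun i => by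
    change 1 / ((i:ℝ) + 1) ≤ 1
    rw [div_le_one (by positivity)]; linarith [(Nat.cast_nonneg i : (0:ℝ) ≤ i)]
  let ψ : ℕ → En n → ℝ := fun i =>
    convolution ((ρ i).normed volume) φ (ContinuousLinearMap.lsmul ℝ ℝ) volume
  have hgc : Continuous (fderiv ℝ φ) := hφ.continuous_fderiv one_ne_zero
  have hgs : HasCompactSupport (fderiv ℝ φ) := hc.fderiv ℝ
  have hfc : Continuous (fderiv ℝ f) := hf.continuous_fderiv one_ne_zero
  have hψ1 : ∀ i, ContDiff ℝ (⊤ : ℕ∞) (ψ i) := fun i =>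
    (ρ i).hasCompactSupport_normed.contDiff_convolution_left _ (ρ i).contDiff_normed
      hφ.continuous.locallyIntegrable
  have hψ2 : ∀ i, HasCompactSupport (ψ i) := fun i =>
    (ρ i).hasCompactSupport_normed.convolution _ hc
  have hψ3 : ∀ i x, fderiv ℝ (ψ i) x =
      convolution ((ρ i).normed volume) (fderiv ℝ φ) (ContinuousLinearMap.lsmul ℝ ℝ) volume x := by
    intro i x
    have := hc.hasFDerivAt_convolution_right (μ := volume) (ContinuousLinearMap.lsmul ℝ ℝ)
      ((ρ i).continuous_normed (μ := volume)).locallyIntegrable hφ x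
    rw [this.fderiv]
    rfl
  obtain ⟨M, hM⟩ := hgc.bounded_above_of_compact_support hgs
  have hM0 : 0 ≤ M := (norm_nonneg _).trans (hM 0)
  obtain ⟨R, hR⟩ := hgs.isCompact.isBounded.subset_closedBall (0 : En n)
  have hψb : ∀ i x, ‖fderiv ℝ (ψ i) x‖ ≤ 3 * M := by
    intro i x
    have h1 := (ρ i).dist_normed_convolution_le (μ := volume) (g := fderiv ℝ φ) (x₀ := x)
      (ε := 2 * M) hgc.aestronglyMeasurable (fun y _ => by
        rw [dist_eq_norm]
        have := norm_sub_le (fderiv ℝ φ y) (fderiv ℝ φ x)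
        linarith [hM x, hM y])
    rw [← hψ3, dist_eq_norm] at h1
    have := norm_le_norm_add_norm_sub' (fderiv ℝ (ψ i) x) (fderiv ℝ φ x)
    linarith [hM x]
  have hψ0 : ∀ i x, x ∉ closedBall (0 : En n) (R + 1) → fderiv ℝ (ψ i) x = 0 := by
    intro i x hx
    have h0 : ∀ y ∈ ball x (ρ i).rOut, fderiv ℝ φ y = 0 := by
      intro y hy
      refine image_eq_zero_of_notMem_tsupport fun hy' => hx ?_
      have h1 := hR hy'
      simp only [mem_closedBall, dist_zero_right, mem_ball] at *
      have h2 := norm_le_norm_add_norm_sub' x y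
      rw [← dist_eq_norm, dist_comm] at h2
      linarith [hρ1 i]
    rw [hψ3, (ρ i).normed_convolution_eq_right (fun y hy => by
      rw [h0 y hy, h0 x (mem_ball_self (ρ i).rOut_pos)])]
    exact h0 x (mem_ball_self (ρ i).rOut_pos)
  have key := tendsto_integral_of_dominated_convergence (μ := volume)
    (F := fun i x => bf (a x) (fderiv ℝ f x) (fderiv ℝ (ψ i) x))
    (f := fun x => bf (a x) (fderiv ℝ f x) (fderiv ℝ φ x))
    ((closedBall (0 : En n) (R + 1)).indicator fun x => n * n * ε⁻¹ * (‖fderiv ℝ f x‖ * (3 * M)))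
    (fun i => (h.bf_meas hfc ((hψ1 i).continuous_fderiv (by simp))).aestronglyMeasurable)
    (by
      rw [integrable_indicator_iff measurableSet_closedBall]
      have hcc : Continuous fun x => n * n * ε⁻¹ * (‖fderiv ℝ f x‖ * (3 * M)) := by fun_prop
      exact hcc.continuousOn.integrableOn_compact (isCompact_closedBall _ _))
    (fun i => Eventually.of_forall fun x => by
      by_cases hx : x ∈ closedBall (0 : En n) (R + 1)
      · rw [Set.indicator_of_mem hx]
        refine (h.bf_abs x _ _).trans ?_
        have := hψb i x
        have h0 : 0 ≤ ε⁻¹ := inv_nonneg.2 h.eps.le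
        gcongr
      · rw [Set.indicator_of_notMem hx, hψ0 i x hx]
        have : bf (a x) (fderiv ℝ f x) 0 = 0 := by
          simpa using bf_smul_right (a x) (fderiv ℝ f x) 0 0
        simp [this])
    (Eventually.of_forall fun x => by
      refine ((bf_cont_right (a x) (fderiv ℝ f x)).tendsto _).comp ?_
      simp only [hψ3]
      exact ContDiffBump.convolution_tendsto_right_of_continuous hρ hgc x)
  have h0 : (fun i => ∫ x, bf (a x) (fderiv ℝ f x) (fderiv ℝ (ψ i) x)) = fun _ => 0 := by
    funext i; exact hw _ (hψ1 i) (hψ2 i)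
  rw [h0] at key
  exact (tendsto_nhds_unique key tendsto_const_nhds)

/-- The log transform. -/
lemma log_identity (h : Ell n ε a) {f W : En n → ℝ} (hf : ContDiff ℝ 1 f) (hw : Weak n a f)
    (hpos : ∀ x, 0 < f x) (c : ℝ) (hW : W = fun x => c - Real.log (f x))
    {φ : En n → ℝ} (hφ : ContDiff ℝ 1 φ) (hc : HasCompactSupport φ) :
    ∫ x, (bf (a x) (fderiv ℝ W x) (fderiv ℝ φ x) +
      φ x * bf (a x) (fderiv ℝ W x) (fderiv ℝ W x)) = 0 := by
  have hne : ∀ x, f x ≠ 0 := fun x => (hpos x).ne'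
  have h1 : ContDiff ℝ 1 fun x => φ x * (f x)⁻¹ := hφ.mul (hf.inv hne)
  have h2 : HasCompactSupport fun x => φ x * (f x)⁻¹ := hc.mul_right
  have h3 := h.weak_C1 hf hw h1 h2
  rw [← neg_eq_zero, ← integral_neg]
  rw [← h3]
  refine integral_congr_ae (Filter.Eventually.of_forall fun x => ?_)
  have df : HasFDerivAt f (fderiv ℝ f x) x := (hf.differentiable one_ne_zero x).hasFDerivAt
  have dφ : HasFDerivAt φ (fderiv ℝ φ x) x := (hφ.differentiable one_ne_zero x).hasFDerivAt
  have dW : fderiv ℝ W x = (-(f x)⁻¹) • fderiv ℝ f x := by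
    rw [hW]
    have := (df.log (hne x)).const_sub c
    rw [this.fderiv, neg_smul]
  have dψ : fderiv ℝ (fun x => φ x * (f x)⁻¹) x =
      (-(φ x * ((f x)⁻¹ * (f x)⁻¹))) • fderiv ℝ f x + (f x)⁻¹ • fderiv ℝ φ x := by
    have := dφ.mul ((hasDerivAt_inv (hne x)).comp_hasFDerivAt x df)
    refine (this.fderiv).trans ?_
    ext v
    simp
    field_simp
  simp only [dW, dψ, bf_add_right, bf_smul_right, bf_smul_left]
  ring

lemma cacc (h : Ell n ε a) {f W : En n → ℝ} (hf : ContDiff ℝ 1 f) (hw : Weak n a f)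
    (hpos : ∀ x, 0 < f x) (c : ℝ) (hW : W = fun x => c - Real.log (f x))
    {φ P K : En n → ℝ} (hφ : ContDiff ℝ 1 φ) (hc : HasCompactSupport φ) (hφ0 : ∀ x, 0 ≤ φ x)
    (V : En n → (En n →L[ℝ] ℝ)) (hP : ∀ x, 0 ≤ P x)
    (hd : ∀ x, fderiv ℝ φ x = P x • fderiv ℝ W x + V x)
    (hK0 : ∀ x, 0 ≤ K x) (hKi : Integrable K) (hK : ∀ x, bf (a x) (V x) (V x) ≤ φ x * K x) :
    ε * ∫ x, φ x * ‖fderiv ℝ W x‖ ^ 2 ≤ ∫ x, K x := by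
  have hWc : ContDiff ℝ 1 W := by
    rw [hW]; exact contDiff_const.sub (hf.log fun x => (hpos x).ne')
  have hWd : Continuous (fderiv ℝ W) := hWc.continuous_fderiv one_ne_zero
  have h1 := h.log_identity hf hw hpos c hW hφ hc
  have i1 : Integrable fun x => bf (a x) (fderiv ℝ W x) (fderiv ℝ φ x) :=
    h.bf_int hWd (hφ.continuous_fderiv one_ne_zero) (hc.fderiv ℝ)
  have i2 : Integrable fun x => φ x * bf (a x) (fderiv ℝ W x) (fderiv ℝ W x) := by
    simp only [← bf_smul_right]
    exact h.bf_int hWd (hφ.continuous.smul hWd) (hc.smul_right)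
  rw [integral_add i1 i2] at h1
  have i3 : Integrable fun x => φ x * ‖fderiv ℝ W x‖ ^ 2 :=
    (hφ.continuous.mul (hWd.norm.pow 2)).integrable_of_hasCompactSupport hc.mul_right
  have h2 : - ∫ x, bf (a x) (fderiv ℝ W x) (fderiv ℝ φ x) ≤
      ∫ x, (φ x * bf (a x) (fderiv ℝ W x) (fderiv ℝ W x) + K x) / 2 := by
    rw [← integral_neg]
    refine integral_mono i1.neg ((i2.add hKi).div_const 2) fun x => ?_
    have := h.cs x (fderiv ℝ W x) (V x) (φ x) (K x) (hφ0 x) (hK0 x) (hK x)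
    have h3 := mul_nonneg (hP x) (h.nonneg x (fderiv ℝ W x))
    simp only [hd, bf_add_right, bf_smul_right]
    linarith
  rw [integral_div, integral_add i2 hKi] at h2
  have h3 : ∫ x, ε * (φ x * ‖fderiv ℝ W x‖ ^ 2) ≤
      ∫ x, φ x * bf (a x) (fderiv ℝ W x) (fderiv ℝ W x) := by
    refine integral_mono (i3.const_mul _) i2 fun x => ?_
    have := mul_le_mul_of_nonneg_left (h.lower x (fderiv ℝ W x)) (hφ0 x)
    simp only
    linarith
  rw [integral_const_mul] at h3
  linarith
end Ell

section poincare
variable {n : ℕ}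
open scoped ENNReal

lemma lintegral_affine_le (G : En n → ℝ≥0∞) (hG : Measurable G) (s : ℝ) (hs : 1 / 2 ≤ s) (v : En n)
    (hv : ∀ x ∈ ball (0 : En n) 1, s • x + v ∈ ball (0 : En n) 1) :
    ∫⁻ x in ball (0 : En n) 1, G (s • x + v) ≤ 2 ^ n * ∫⁻ x in ball (0 : En n) 1, G x := by
  have hs0 : 0 < s := by linarith
  rw [← lintegral_indicator measurableSet_ball, ← lintegral_indicator measurableSet_ball]
  set H := (ball (0 : En n) 1).indicator G with hH
  have hHm : Measurable H := hG.indicator measurableSet_ball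
  calc _ ≤ ∫⁻ x, H (s • x + v) := by
        refine lintegral_mono fun x => ?_
        by_cases hx : x ∈ ball (0 : En n) 1
        · rw [Set.indicator_of_mem hx, hH, Set.indicator_of_mem (hv x hx)]
        · rw [Set.indicator_of_notMem hx]; exact zero_le
    _ = ∫⁻ y, H (y + v) ∂(Measure.map (fun x : En n => s • x) volume) := by
        exact (lintegral_map (f := fun y => H (y + v)) (hHm.comp (measurable_add_const v))
          (measurable_const_smul s)).symm
    _ = ENNReal.ofReal (|(s ^ n)⁻¹|) * ∫⁻ y, H (y + v) := by
        rw [Measure.map_addHaar_smul volume hs0.ne', lintegral_smul_measure]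
        simp
    _ = ENNReal.ofReal (|(s ^ n)⁻¹|) * ∫⁻ y, H y := by rw [lintegral_add_right_eq_self]
    _ ≤ _ := by
        gcongr
        rw [show (2:ℝ≥0∞) ^ n = ENNReal.ofReal (2 ^ n) by
          rw [ENNReal.ofReal_pow (by norm_num)]; simp]
        apply ENNReal.ofReal_le_ofReal
        rw [abs_of_nonneg (by positivity), ← inv_pow]
        gcongr
        rw [inv_le_comm₀ hs0 (by norm_num)]
        linarith

lemma line_bound {g : En n → ℝ} (hg : ContDiff ℝ 1 g) (x z : En n)
    (hx : x ∈ ball (0 : En n) 1) (hz : z ∈ ball (0 : En n) 1) :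
    ENNReal.ofReal (g x) ≤ ENNReal.ofReal (g z) +
      2 * ∫⁻ t in Set.Icc (0:ℝ) 1, ‖fderiv ℝ g ((1 - t) • x + t • z)‖ₑ := by
  have hgd : Continuous (fderiv ℝ g) := hg.continuous_fderiv one_ne_zero
  have hd : ∀ t ∈ Set.uIcc (0:ℝ) 1, HasDerivAt (fun t : ℝ => g ((1 - t) • x + t • z))
      (fderiv ℝ g ((1 - t) • x + t • z) (z - x)) t := by
    intro t _
    have h1 : HasDerivAt (fun t : ℝ => (1 - t) • x + t • z) (z - x) t := by
      have e1 := ((hasDerivAt_id t).const_sub 1).smul_const x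
      have e2 := (hasDerivAt_id t).smul_const z
      refine (e1.add e2).congr_deriv ?_
      simp; abel
    exact (hg.differentiable one_ne_zero _).hasFDerivAt.comp_hasDerivAt t h1
  have hcd : Continuous fun t : ℝ => fderiv ℝ g ((1 - t) • x + t • z) := by fun_prop
  have hcont : Continuous fun t : ℝ => fderiv ℝ g ((1 - t) • x + t • z) (z - x) := by fun_prop
  have hftc := intervalIntegral.integral_eq_sub_of_hasDerivAt hd (hcont.intervalIntegrable 0 1)
  simp only [sub_self, zero_smul, one_smul, zero_add, sub_zero, add_zero] at hftc
  have hle : g x ≤ g z + ∫ t in Set.Icc (0:ℝ) 1, 2 * ‖fderiv ℝ g ((1 - t) • x + t • z)‖ := by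
    have h1 : g x - g z = - ∫ t in (0:ℝ)..1, fderiv ℝ g ((1 - t) • x + t • z) (z - x) := by
      rw [hftc]; ring
    have h2 : - (∫ t in (0:ℝ)..1, fderiv ℝ g ((1 - t) • x + t • z) (z - x)) ≤
        ∫ t in (0:ℝ)..1, 2 * ‖fderiv ℝ g ((1 - t) • x + t • z)‖ := by
      rw [← intervalIntegral.integral_neg]
      refine intervalIntegral.integral_mono_on zero_le_one (hcont.neg.intervalIntegrable 0 1)
        (Continuous.intervalIntegrable (by fun_prop) 0 1) fun t _ => ?_
      have h3 := (fderiv ℝ g ((1 - t) • x + t • z)).le_opNorm (z - x)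
      have h4 : ‖z - x‖ ≤ 2 := by
        have := norm_sub_le z x
        simp only [mem_ball, dist_zero_right] at hx hz
        linarith
      rw [Real.norm_eq_abs] at h3
      have h5 := neg_abs_le (fderiv ℝ g ((1 - t) • x + t • z) (z - x))
      have h6 := mul_le_mul_of_nonneg_left h4 (norm_nonneg (fderiv ℝ g ((1 - t) • x + t • z)))
      linarith
    rw [integral_Icc_eq_integral_Ioc, ← intervalIntegral.integral_of_le zero_le_one]
    linarith
  refine (ENNReal.ofReal_le_ofReal hle).trans (ENNReal.ofReal_add_le.trans ?_)
  gcongr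
  rw [integral_const_mul, ENNReal.ofReal_mul (by norm_num), ofReal_integral_norm_eq_lintegral_enorm]
  · simp
  · exact hcd.continuousOn.integrableOn_compact isCompact_Icc

lemma poincare {g : En n → ℝ} (hg : ContDiff ℝ 1 g) (Z : Set (En n)) (hZm : MeasurableSet Z)
    (hZ : Z ⊆ ball 0 1) (hZv : volume (ball (0 : En n) 1) ≤ 2 * volume Z) (C₀ : ℝ)
    (hC : ∀ z ∈ Z, g z ≤ C₀) :
    ∫⁻ x in ball (0 : En n) 1, ENNReal.ofReal (g x) ≤
      ENNReal.ofReal C₀ * volume (ball (0 : En n) 1) +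
        2 ^ (n + 2) * ∫⁻ x in ball (0 : En n) 1, ‖fderiv ℝ g x‖ₑ := by
  have hgd : Continuous (fderiv ℝ g) := hg.continuous_fderiv one_ne_zero
  set B := ball (0 : En n) 1 with hB
  set G : En n → ℝ≥0∞ := fun x => ‖fderiv ℝ g x‖ₑ with hGdef
  have hGc : Continuous G := by fun_prop
  have hBfin : volume B ≠ ∞ := measure_ball_lt_top.ne
  have hBpos : volume B ≠ 0 := (measure_ball_pos volume _ one_pos).ne'
  have hZfin : volume Z ≠ ∞ := ne_top_of_le_ne_top hBfin (measure_mono hZ)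
  have hZpos : volume Z ≠ 0 := by
    intro h0; rw [h0, mul_zero] at hZv; exact hBpos (le_antisymm hZv zero_le)
  have hconv : ∀ t ∈ Set.Icc (0:ℝ) 1, ∀ x ∈ B, ∀ z ∈ B, (1 - t) • x + t • z ∈ B := by
    intro t ht x hx z hz
    exact (convex_ball (0 : En n) 1) hx hz (by linarith [ht.2]) ht.1 (by ring)
  -- bound for fixed t
  have hT : ∀ t ∈ Set.Icc (0:ℝ) 1, ∫⁻ z in B, ∫⁻ x in B, G ((1 - t) • x + t • z) ≤
      2 ^ n * (∫⁻ x in B, G x) * volume B := by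
    intro t ht
    rcases le_total t (1/2) with h | h
    · calc _ ≤ ∫⁻ z in B, 2 ^ n * (∫⁻ x in B, G x) := by
            refine setLIntegral_mono measurable_const fun z hz => ?_
            exact lintegral_affine_le G hGc.measurable (1 - t) (by linarith) (t • z)
              fun x hx => hconv t ht x hx z hz
        _ = _ := by simp
    · rw [lintegral_lintegral_swap (by
        have : Continuous (Function.uncurry fun z x => G ((1 - t) • x + t • z)) := by
          unfold Function.uncurry; fun_prop
        exact this.measurable.aemeasurable)]
      calc _ ≤ ∫⁻ x in B, 2 ^ n * (∫⁻ x in B, G x) := by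
            refine setLIntegral_mono measurable_const fun x hx => ?_
            have := lintegral_affine_le G hGc.measurable t (by linarith) ((1 - t) • x)
              fun z hz => by rw [add_comm]; exact hconv t ht x hx z hz
            simpa only [add_comm] using this
        _ = _ := by simp
  have hmain : volume Z * ∫⁻ x in B, ENNReal.ofReal (g x) ≤
      ENNReal.ofReal C₀ * volume B * volume Z + 2 * (2 ^ n * (∫⁻ x in B, G x) * volume B) := by
    have hI : Measurable (Function.uncurry fun z x : En n =>
        ∫⁻ t in Set.Icc (0:ℝ) 1, G ((1 - t) • x + t • z)) := by
      have : Continuous fun p : (En n × En n) × ℝ => G ((1 - p.2) • p.1.2 + p.2 • p.1.1) := by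
        fun_prop
      exact Measurable.lintegral_prod_right' (ν := volume.restrict (Set.Icc (0:ℝ) 1)) this.measurable
    calc volume Z * ∫⁻ x in B, ENNReal.ofReal (g x)
        = ∫⁻ z in Z, ∫⁻ x in B, ENNReal.ofReal (g x) := by simp [mul_comm]
      _ ≤ ∫⁻ z in Z, (ENNReal.ofReal C₀ * volume B +
            2 * ∫⁻ x in B, ∫⁻ t in Set.Icc (0:ℝ) 1, G ((1 - t) • x + t • z)) := by
          refine setLIntegral_mono' hZm fun z hz => ?_
          calc _ ≤ ∫⁻ x in B, (ENNReal.ofReal C₀ +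
                2 * ∫⁻ t in Set.Icc (0:ℝ) 1, G ((1 - t) • x + t • z)) := by
                refine setLIntegral_mono' measurableSet_ball fun x hx => ?_
                refine (line_bound hg x z hx (hZ hz)).trans ?_
                gcongr
                exact hC z hz
            _ = _ := by
                rw [lintegral_add_left measurable_const, lintegral_const_mul' _ _ (by simp)]
                simp
      _ = ENNReal.ofReal C₀ * volume B * volume Z +
            2 * ∫⁻ z in Z, ∫⁻ x in B, ∫⁻ t in Set.Icc (0:ℝ) 1, G ((1 - t) • x + t • z) := by
          rw [lintegral_add_left measurable_const, setLIntegral_const,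
            lintegral_const_mul' _ _ (by simp)]
      _ ≤ ENNReal.ofReal C₀ * volume B * volume Z +
            2 * ∫⁻ z in B, ∫⁻ x in B, ∫⁻ t in Set.Icc (0:ℝ) 1, G ((1 - t) • x + t • z) := by
          gcongr
      _ = ENNReal.ofReal C₀ * volume B * volume Z +
            2 * ∫⁻ t in Set.Icc (0:ℝ) 1, ∫⁻ z in B, ∫⁻ x in B, G ((1 - t) • x + t • z) := by
          congr 2
          have e1 : ∀ z, ∫⁻ x in B, ∫⁻ t in Set.Icc (0:ℝ) 1, G ((1 - t) • x + t • z) =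
              ∫⁻ t in Set.Icc (0:ℝ) 1, ∫⁻ x in B, G ((1 - t) • x + t • z) := by
            intro z
            refine lintegral_lintegral_swap ?_
            have : Continuous (Function.uncurry fun (x : En n) (t : ℝ) => G ((1 - t) • x + t • z)) := by
              unfold Function.uncurry; fun_prop
            exact this.measurable.aemeasurable
          simp only [e1]
          refine lintegral_lintegral_swap ?_
          have : Continuous fun p : (En n × ℝ) × En n => G ((1 - p.1.2) • p.2 + p.1.2 • p.1.1) := by
            fun_prop
          exact (Measurable.lintegral_prod_right' (ν := volume.restrict B) this.measurable).aemeasurable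
      _ ≤ ENNReal.ofReal C₀ * volume B * volume Z +
            2 * ∫⁻ t in Set.Icc (0:ℝ) 1, 2 ^ n * (∫⁻ x in B, G x) * volume B := by
          refine add_le_add_right (mul_le_mul_right ?_ _) _
          exact setLIntegral_mono measurable_const hT
      _ = _ := by simp
  have h2 : volume Z * ∫⁻ x in B, ENNReal.ofReal (g x) ≤ volume Z *
      (ENNReal.ofReal C₀ * volume B + 2 ^ (n + 2) * ∫⁻ x in B, G x) := by
    refine hmain.trans ?_
    calc _ ≤ ENNReal.ofReal C₀ * volume B * volume Z +
          2 * (2 ^ n * (∫⁻ x in B, G x) * (2 * volume Z)) := by gcongr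
      _ = _ := by ring
  exact (ENNReal.mul_le_mul_iff_right hZpos hZfin).1 h2
end poincare

lemma intOn_ball {n : ℕ} {g : En n → ℝ} (hg : Continuous g) : IntegrableOn g (ball (0 : En n) 1) :=
  (hg.continuousOn.integrableOn_compact (isCompact_closedBall 0 1)).mono_set ball_subset_closedBall

lemma poincare_real {n : ℕ} {g : En n → ℝ} (hg : ContDiff ℝ 1 g) (hg0 : ∀ x, 0 ≤ g x)
    (Z : Set (En n)) (hZm : MeasurableSet Z)
    (hZ : Z ⊆ ball 0 1) (hZv : volume (ball (0 : En n) 1) ≤ 2 * volume Z) (C₀ : ℝ) (hC0 : 0 ≤ C₀)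
    (hC : ∀ z ∈ Z, g z ≤ C₀) :
    ∫ x in ball (0 : En n) 1, g x ≤
      C₀ * volume.real (ball (0 : En n) 1) +
        2 ^ (n + 2) * ∫ x in ball (0 : En n) 1, ‖fderiv ℝ g x‖ := by
  have hgd : Continuous (fderiv ℝ g) := hg.continuous_fderiv one_ne_zero
  have h := poincare hg Z hZm hZ hZv C₀ hC
  rw [← ofReal_integral_eq_lintegral_ofReal (intOn_ball hg.continuous)
    (Filter.Eventually.of_forall hg0)] at h
  have h2 : ∫⁻ x in ball (0 : En n) 1, ‖fderiv ℝ g x‖ₑ =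
      ENNReal.ofReal (∫ x in ball (0 : En n) 1, ‖fderiv ℝ g x‖) := by
    rw [ofReal_integral_norm_eq_lintegral_enorm]
    exact (hgd.continuousOn.integrableOn_compact (isCompact_closedBall 0 1)).mono_set
      ball_subset_closedBall
  have h3 : volume (ball (0 : En n) 1) = ENNReal.ofReal (volume.real (ball (0 : En n) 1)) := by
    rw [ofReal_measureReal measure_ball_lt_top.ne]
  have h4 : (2 : ENNReal) ^ (n + 2) = ENNReal.ofReal (2 ^ (n + 2)) := by
    rw [ENNReal.ofReal_pow (by norm_num)]; simp
  have h5 : 0 ≤ ∫ x in ball (0 : En n) 1, ‖fderiv ℝ g x‖ := integral_nonneg fun x => norm_nonneg _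
  rw [h2, h3, h4, ← ENNReal.ofReal_mul hC0, ← ENNReal.ofReal_mul (by positivity),
    ← ENNReal.ofReal_add (by positivity) (by positivity)] at h
  exact (ENNReal.ofReal_le_ofReal_iff (by positivity)).1 h

/-- The data: a positive solution bounded by two and its log transform. -/
structure LogSol (n : ℕ) (ε : ℝ) (a : En n → Matrix (Fin n) (Fin n) ℝ) (f W : En n → ℝ) : Prop where
  ell : Ell n ε a
  cd : ContDiff ℝ 1 f
  weak : Weak n a f
  pos : ∀ x, 0 < f x
  le2 : ∀ x, f x ≤ 2
  hW : W = fun x => (1 + Real.log 2) - Real.log (f x)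

namespace LogSol
variable {n : ℕ} {ε : ℝ} {a : En n → Matrix (Fin n) (Fin n) ℝ} {f W : En n → ℝ}

lemma one_le (h : LogSol n ε a f W) (x : En n) : 1 ≤ W x := by
  rw [h.hW]
  have := Real.log_le_log (h.pos x) (h.le2 x)
  simp only; linarith

lemma wcd (h : LogSol n ε a f W) : ContDiff ℝ 1 W := by
  rw [h.hW]; exact contDiff_const.sub (h.cd.log fun x => (h.pos x).ne')

lemma energy (n : ℕ) (ε : ℝ) : ∃ C : ℝ, 0 ≤ C ∧ ∀ a f W, LogSol n ε a f W →
    ∫ x in ball (0 : En n) 1, ‖fderiv ℝ W x‖ ^ 2 ≤ C := by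
  let η : ContDiffBump (0 : En n) := ⟨1, 2, by norm_num, by norm_num⟩
  have hη : ContDiff ℝ 1 η := η.contDiff
  have hηc : HasCompactSupport η := η.hasCompactSupport
  have hηd : Continuous (fderiv ℝ η) := hη.continuous_fderiv one_ne_zero
  refine ⟨|ε⁻¹ * ∫ x, (4 * ε⁻¹ * n) * ‖fderiv ℝ η x‖ ^ 2|, abs_nonneg _, fun a f W h => ?_⟩
  have hε := h.ell.eps
  have hWd : Continuous (fderiv ℝ W) := h.wcd.continuous_fderiv one_ne_zero
  have hφc : HasCompactSupport fun x => η x ^ 2 :=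
    hηc.comp_left (g := fun t : ℝ => t ^ 2) (by simp)
  have key := h.ell.cacc h.cd h.weak h.pos _ h.hW (φ := fun x => η x ^ 2) (P := fun _ => 0)
    (K := fun x => (4 * ε⁻¹ * n) * ‖fderiv ℝ η x‖ ^ 2) (hη.pow 2) hφc (fun x => sq_nonneg _)
    (fun x => (2 * η x) • fderiv ℝ η x) (fun _ => le_rfl) (fun x => by
      have := (hη.differentiable one_ne_zero x).hasFDerivAt.pow 2
      rw [this.fderiv]; simp)
    (fun x => by positivity)
    (by
      refine Continuous.integrable_of_hasCompactSupport (by fun_prop) ?_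
      exact ((hηc.fderiv ℝ).comp_left (g := fun l => (4 * ε⁻¹ * n) * ‖l‖ ^ 2) (by simp)))
    (fun x => by
      rw [bf_smul_left, bf_smul_right]
      have := mul_le_mul_of_nonneg_left (h.ell.upper x (fderiv ℝ η x)) (sq_nonneg (2 * η x))
      linarith)
  have h1 : ∫ x in ball (0 : En n) 1, ‖fderiv ℝ W x‖ ^ 2 ≤ ∫ x, η x ^ 2 * ‖fderiv ℝ W x‖ ^ 2 := by
    rw [← integral_indicator measurableSet_ball]
    refine integral_mono ((integrable_indicator_iff measurableSet_ball).2 (intOn_ball (by fun_prop)))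
      (((hη.continuous.pow 2).mul (hWd.norm.pow 2)).integrable_of_hasCompactSupport hφc.mul_right)
      fun x => ?_
    by_cases hx : x ∈ ball (0 : En n) 1
    · rw [Set.indicator_of_mem hx]
      have : η x = 1 := η.one_of_mem_closedBall (ball_subset_closedBall hx)
      simp [this]
    · rw [Set.indicator_of_notMem hx]; positivity
  refine h1.trans (le_trans ?_ (le_abs_self _))
  rw [inv_mul_eq_div, le_div_iff₀' hε]
  exact key

lemma l2 (n : ℕ) (ε : ℝ) : ∃ C : ℝ, 0 ≤ C ∧ ∀ a f W, LogSol n ε a f W →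
    (volume (ball (0 : En n) 1) ≤ 2 * volume (ball (0 : En n) 1 ∩ {x | 1 / 2 ≤ f x})) →
    ∫ x in ball (0 : En n) 1, W x ^ 2 ≤ C := by
  obtain ⟨C1, hC1, hE⟩ := energy n ε
  refine ⟨2 * ((1 + Real.log 4) ^ 2 * volume.real (ball (0 : En n) 1)) + (2 ^ (n + 3)) ^ 2 * C1,
    by positivity, fun a f W h hZ => ?_⟩
  have hE := hE a f W h
  have hWc := h.wcd
  have hWd : Continuous (fderiv ℝ W) := h.wcd.continuous_fderiv one_ne_zero
  have hWcc := hWc.continuous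
  have hl4 : Real.log 4 = Real.log 2 + Real.log 2 := by
    rw [← Real.log_mul (by norm_num) (by norm_num)]; norm_num
  have hp := poincare_real (hWc.pow 2) (fun x => sq_nonneg (W x)) _
    (measurableSet_ball.inter (measurableSet_le measurable_const h.cd.continuous.measurable))
    Set.inter_subset_left hZ ((1 + Real.log 4) ^ 2) (sq_nonneg _) (by
      rintro z ⟨_, hz⟩
      have h1 := h.one_le z
      have h2 : W z ≤ 1 + Real.log 4 := by
        have := Real.log_le_log (by norm_num) (show 1/2 ≤ f z from hz)
        rw [h.hW, hl4]
        rw [one_div, Real.log_inv] at this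
        simp only; linarith
      gcongr)
  have hd : ∀ x, fderiv ℝ (fun x => W x ^ 2) x = (2 * W x) • fderiv ℝ W x := fun x => by
    have := (hWc.differentiable one_ne_zero x).hasFDerivAt.pow 2
    rw [this.fderiv]; simp
  have h3 : 2 ^ (n + 2) * ∫ x in ball (0 : En n) 1, ‖fderiv ℝ (fun x => W x ^ 2) x‖ ≤
      ∫ x in ball (0 : En n) 1, (1 / 2 * W x ^ 2 + 1 / 2 * (2 ^ (n + 3)) ^ 2 * ‖fderiv ℝ W x‖ ^ 2) := by
    rw [← integral_const_mul]
    refine integral_mono (intOn_ball ?_) (intOn_ball (by fun_prop)) fun x => ?_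
    · simp only [hd]; fun_prop
    · simp only [hd, norm_smul, norm_mul, Real.norm_eq_abs]
      rw [abs_of_nonneg (by linarith [h.one_le x] : 0 ≤ W x)]
      have := sq_nonneg (W x - 2 ^ (n + 3) * ‖fderiv ℝ W x‖)
      simp only [abs_two]
      have e : (2:ℝ) ^ (n + 3) = 2 * 2 ^ (n + 2) := by ring
      rw [e] at this ⊢
      nlinarith
  rw [integral_add (intOn_ball (by fun_prop)) (intOn_ball (by fun_prop)), integral_const_mul,
    integral_const_mul] at h3
  have h4 := mul_le_mul_of_nonneg_left hE (show (0:ℝ) ≤ 1 / 2 * (2 ^ (n + 3)) ^ 2 by positivity)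
  linarith

end LogSol

/-- The fixed cutoff function. -/
def cutoff (n : ℕ) : ContDiffBump (0 : En n) := ⟨1 / 2, 1, by norm_num, by norm_num⟩

/-- weighted integrals for the Moser iteration -/
def mJ (n : ℕ) (W : En n → ℝ) (s q : ℝ) : ℝ := ∫ x, (cutoff n x) ^ s * (W x) ^ q

namespace LogSol
variable {n : ℕ} {ε : ℝ} {a : En n → Matrix (Fin n) (Fin n) ℝ} {f W : En n → ℝ}

lemma eta_cs (s : ℝ) (hs : 0 < s) : HasCompactSupport fun x => (cutoff n x) ^ s :=
  (cutoff n).hasCompactSupport.comp_left (g := fun t : ℝ => t ^ s) (by simp [hs.ne'])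

lemma eta_cont (s : ℝ) (hs : 0 < s) : Continuous fun x => (cutoff n x) ^ s :=
  (cutoff n).continuous.rpow_const fun _ => Or.inr hs.le

lemma W_cont (h : LogSol n ε a f W) (q : ℝ) : Continuous fun x => W x ^ q :=
  h.wcd.continuous.rpow_const fun x => Or.inl (by linarith [h.one_le x])

lemma J_int (h : LogSol n ε a f W) (s q : ℝ) (hs : 0 < s) :
    Integrable fun x => (cutoff n x) ^ s * (W x) ^ q :=
  ((eta_cont s hs).mul (h.W_cont q)).integrable_of_hasCompactSupport (eta_cs s hs).mul_right

lemma test_cd (h : LogSol n ε a f W) (s q : ℝ) (hs : 1 ≤ s) :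
    ContDiff ℝ 1 fun x => (cutoff n x) ^ s * (W x) ^ q :=
  ((cutoff n).contDiff.rpow_const_of_le (by simpa using hs)).mul
    (h.wcd.rpow_const_of_ne fun x => by linarith [h.one_le x])

lemma test_fderiv (h : LogSol n ε a f W) (s q : ℝ) (hs : 1 ≤ s) (x : En n) :
    fderiv ℝ (fun x => (cutoff n x) ^ s * (W x) ^ q) x =
      ((cutoff n x) ^ s * (q * W x ^ (q - 1))) • fderiv ℝ W x +
        (s * (cutoff n x) ^ (s - 1) * W x ^ q) • fderiv ℝ (cutoff n) x := by
  have hη : ContDiff ℝ 1 (cutoff n) := (cutoff n).contDiff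
  have d1 := (hη.differentiable one_ne_zero x).hasFDerivAt.rpow_const (p := s) (Or.inr hs)
  have d2 := (h.wcd.differentiable one_ne_zero x).hasFDerivAt.rpow_const (p := q)
    (Or.inl (by linarith [h.one_le x]))
  refine (d1.mul d2).fderiv.trans ?_
  rw [smul_smul, smul_smul]
  congr 2
  ring

lemma moser_grad (n : ℕ) (ε : ℝ) : ∃ C : ℝ, 0 ≤ C ∧ ∀ a f W, LogSol n ε a f W →
    ∀ s q : ℝ, 1 ≤ s → 2 ≤ q →
    ∫ x, ‖fderiv ℝ (fun x => (cutoff n x) ^ (s + 1) * (W x) ^ q) x‖ ≤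
      C * ((s + 2) ^ 2 * q) * mJ n W s q := by
  have hη : ContDiff ℝ 1 (cutoff n) := (cutoff n).contDiff
  have hηd : Continuous (fderiv ℝ (cutoff n)) := hη.continuous_fderiv one_ne_zero
  obtain ⟨L, hL⟩ := hηd.bounded_above_of_compact_support ((cutoff n).hasCompactSupport.fderiv ℝ)
  have hL0 : 0 ≤ L := (norm_nonneg _).trans (hL 0)
  refine ⟨L + 1 + ε⁻¹ * ε⁻¹ * n * L ^ 2, ?_, ?_⟩
  · have : 0 ≤ ε⁻¹ * ε⁻¹ := mul_self_nonneg _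
    positivity
  intro a f W h s q hs hq
  have hε := h.ell.eps
  have hWd : Continuous (fderiv ℝ W) := h.wcd.continuous_fderiv one_ne_zero
  have hη0 : ∀ x, 0 ≤ cutoff n x := fun x => (cutoff n).nonneg
  have hW1 := h.one_le
  have hW0 : ∀ x, 0 < W x := fun x => by linarith [hW1 x]
  have eη : ∀ x, ∀ r : ℝ, 1 ≤ r → (cutoff n x) ^ (r + 1) = (cutoff n x) ^ r * cutoff n x := by
    intro x r hr
    rw [Real.rpow_add_one' (hη0 x) (by linarith)]
  have eη2 : ∀ x, (cutoff n x) ^ (s + 2) = (cutoff n x) ^ s * (cutoff n x * cutoff n x) := by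
    intro x
    rw [show s + 2 = (s + 1) + 1 by ring, eη x _ (by linarith), eη x _ hs]; ring
  have eW1 : ∀ x, W x ^ (q - 1) = W x ^ (q - 2) * W x := by
    intro x
    rw [← Real.rpow_add_one (hW0 x).ne']; congr 1; ring
  have eW2 : ∀ x, W x ^ q = W x ^ (q - 2) * (W x * W x) := by
    intro x
    rw [← mul_assoc, ← eW1, ← Real.rpow_add_one (hW0 x).ne']; congr 1; ring
  have hA : ∀ x, 0 ≤ (cutoff n x) ^ s := fun x => Real.rpow_nonneg (hη0 x) _
  have hBq : ∀ x, 0 ≤ W x ^ (q - 2) := fun x => Real.rpow_nonneg (hW0 x).le _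
  have hJ0 : 0 ≤ mJ n W s q := integral_nonneg fun x =>
    mul_nonneg (hA x) (Real.rpow_nonneg (hW0 x).le _)
  have hJi := h.J_int s q (by linarith)
  -- Caccioppoli
  have key := h.ell.cacc h.cd h.weak h.pos _ h.hW
    (φ := fun x => (cutoff n x) ^ (s + 2) * (W x) ^ (q - 2))
    (P := fun x => (cutoff n x) ^ (s + 2) * ((q - 2) * W x ^ (q - 2 - 1)))
    (K := fun x => ((s + 2) ^ 2 * (ε⁻¹ * n * L ^ 2)) * ((cutoff n x) ^ s * (W x) ^ (q - 2)))
    (h.test_cd _ _ (by linarith)) ((eta_cs (s + 2) (by linarith)).mul_right)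
    (fun x => mul_nonneg (Real.rpow_nonneg (hη0 x) _) (hBq x))
    (fun x => ((s + 2) * (cutoff n x) ^ (s + 2 - 1) * W x ^ (q - 2)) • fderiv ℝ (cutoff n) x)
    (fun x => mul_nonneg (Real.rpow_nonneg (hη0 x) _)
      (mul_nonneg (by linarith) (Real.rpow_nonneg (hW0 x).le _)))
    (fun x => h.test_fderiv _ _ (by linarith) x)
    (fun x => by have := hA x; have := hBq x; positivity)
    ((h.J_int s (q - 2) (by linarith)).const_mul _)
    (fun x => by
      rw [bf_smul_left, bf_smul_right, show s + 2 - 1 = s + 1 by ring, eη x _ hs, eη2]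
      have h1 := h.ell.upper x (fderiv ℝ (cutoff n) x)
      have h2 : bf (a x) (fderiv ℝ (cutoff n) x) (fderiv ℝ (cutoff n) x) ≤ ε⁻¹ * n * L ^ 2 := by
        refine h1.trans ?_
        have := hL x
        gcongr
      have h3 := mul_le_mul_of_nonneg_left h2
        (mul_self_nonneg ((s + 2) * ((cutoff n x) ^ s * cutoff n x) * W x ^ (q - 2)))
      calc _ = _ := by rw [← mul_assoc]
        _ ≤ _ := h3
        _ = _ := by ring)
  have hK : ∫ x, ((s + 2) ^ 2 * (ε⁻¹ * n * L ^ 2)) * ((cutoff n x) ^ s * (W x) ^ (q - 2)) ≤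
      ((s + 2) ^ 2 * (ε⁻¹ * n * L ^ 2)) * mJ n W s q := by
    rw [integral_const_mul]
    refine mul_le_mul_of_nonneg_left ?_ (by positivity)
    refine integral_mono (h.J_int s (q - 2) (by linarith)) hJi fun x => ?_
    simp only
    refine mul_le_mul_of_nonneg_left ?_ (hA x)
    exact Real.rpow_le_rpow_of_exponent_le (hW1 x) (by linarith)
  set X := ∫ x, (cutoff n x) ^ (s + 2) * (W x) ^ (q - 2) * ‖fderiv ℝ W x‖ ^ 2 with hX
  have hXle : X ≤ ε⁻¹ * (((s + 2) ^ 2 * (ε⁻¹ * n * L ^ 2)) * mJ n W s q) := by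
    rw [inv_mul_eq_div, le_div_iff₀' hε]
    exact key.trans hK
  have iX : Integrable fun x => (cutoff n x) ^ (s + 2) * (W x) ^ (q - 2) * ‖fderiv ℝ W x‖ ^ 2 := by
    refine Continuous.integrable_of_hasCompactSupport ?_
      ((eta_cs (s + 2) (by linarith)).mul_right.mul_right)
    exact ((eta_cont _ (by linarith)).mul (h.W_cont _)).mul (hWd.norm.pow 2)
  have hz : ContDiff ℝ 1 fun x => (cutoff n x) ^ (s + 1) * (W x) ^ q := h.test_cd _ _ (by linarith)
  have iz : Integrable fun x => ‖fderiv ℝ (fun x => (cutoff n x) ^ (s + 1) * (W x) ^ q) x‖ :=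
    ((hz.continuous_fderiv one_ne_zero).integrable_of_hasCompactSupport
      (((eta_cs (s + 1) (by linarith)).mul_right).fderiv ℝ)).norm
  have h1 : ∫ x, ‖fderiv ℝ (fun x => (cutoff n x) ^ (s + 1) * (W x) ^ q) x‖ ≤
      ∫ x, (((s + 1) * L + q / 2) * ((cutoff n x) ^ s * (W x) ^ q) +
        q / 2 * ((cutoff n x) ^ (s + 2) * (W x) ^ (q - 2) * ‖fderiv ℝ W x‖ ^ 2)) := by
    refine integral_mono iz ((hJi.const_mul _).add (iX.const_mul _)) fun x => ?_
    simp only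
    rw [h.test_fderiv (s + 1) q (by linarith), show s + 1 - 1 = s by ring]
    refine (norm_add_le _ _).trans ?_
    rw [norm_smul, norm_smul, eη x s hs, eη2, eW1, eW2]
    have a1 := hA x
    have a2 := hBq x
    have a3 := hη0 x
    have a4 := hW0 x
    rw [Real.norm_of_nonneg (by positivity), Real.norm_of_nonneg (by positivity)]
    have b1 := mul_le_mul_of_nonneg_left (hL x)
      (show 0 ≤ (s + 1) * cutoff n x ^ s * (W x ^ (q - 2) * (W x * W x)) by positivity)
    have b2 := mul_nonneg (show 0 ≤ q / 2 * (cutoff n x ^ s * W x ^ (q - 2)) by positivity)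
      (sq_nonneg (W x - cutoff n x * ‖fderiv ℝ W x‖))
    nlinarith
  rw [integral_add (hJi.const_mul _) (iX.const_mul _), integral_const_mul, integral_const_mul] at h1
  change _ ≤ ((s + 1) * L + q / 2) * mJ n W s q + q / 2 * X at h1
  refine h1.trans ?_
  have h2 := mul_le_mul_of_nonneg_left hXle (show 0 ≤ q / 2 by linarith)
  have hT : 0 ≤ ε⁻¹ * ε⁻¹ * n * L ^ 2 := by positivity
  set T := ε⁻¹ * ε⁻¹ * n * L ^ 2
  calc _ ≤ ((s + 1) * L + q / 2 + q / 2 * ((s + 2) ^ 2 * T)) * mJ n W s q := by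
        refine le_trans (add_le_add_right h2 _) (le_of_eq ?_)
        simp only [T]; ring
    _ ≤ _ := by
        refine mul_le_mul_of_nonneg_right ?_ hJ0
        have c1 : 1 ≤ (s + 2) ^ 2 := by nlinarith
        have c2 : s + 1 ≤ (s + 2) ^ 2 * q := by nlinarith
        have c3 : q / 2 ≤ (s + 2) ^ 2 * q := by nlinarith
        have d1 := mul_le_mul_of_nonneg_right c2 hL0
        have d2 : q / 2 * ((s + 2) ^ 2 * T) ≤ (s + 2) ^ 2 * q * T := by
          have : 0 ≤ q * ((s + 2) ^ 2 * T) := by positivity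
          nlinarith
        nlinarith

lemma moser_step (n : ℕ) (ε : ℝ) (χ : ℝ) (hχ : Real.HolderConjugate (n : ℝ) χ) :
    ∃ C : ℝ, 1 ≤ C ∧ ∀ a f W, LogSol n ε a f W →
    ∀ s q : ℝ, 1 ≤ s → 2 ≤ q →
    mJ n W ((s + 1) * χ) (q * χ) ≤ (C * ((s + 2) ^ 2 * q) * mJ n W s q) ^ χ := by
  obtain ⟨C, hC, hgrad⟩ := moser_grad n ε
  have hχ1 : 1 < χ := hχ.symm.lt
  have hχ0 : 0 < χ := by linarith
  set S : NNReal := lintegralPowLePowLIntegralFDerivConst (volume : Measure (En n)) χ with hS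
  refine ⟨max 1 ((S : ℝ) ^ χ⁻¹ * C), le_max_left _ _, fun a f W h s q hs hq => ?_⟩
  have hη0 : ∀ x, 0 ≤ cutoff n x := fun x => (cutoff n).nonneg
  have hW0 : ∀ x, 0 < W x := fun x => by linarith [h.one_le x]
  have hJ0 : 0 ≤ mJ n W s q := integral_nonneg fun x =>
    mul_nonneg (Real.rpow_nonneg (hη0 x) _) (Real.rpow_nonneg (hW0 x).le _)
  have hz : ContDiff ℝ 1 fun x => (cutoff n x) ^ (s + 1) * (W x) ^ q := h.test_cd _ _ (by linarith)
  have hzc : HasCompactSupport fun x => (cutoff n x) ^ (s + 1) * (W x) ^ q :=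
    (eta_cs (s + 1) (by linarith)).mul_right
  have sob := lintegral_pow_le_pow_lintegral_fderiv (volume : Measure (En n)) hz hzc (p := χ)
    (by simpa using hχ)
  rw [← ofReal_integral_norm_eq_lintegral_enorm
    ((hz.continuous_fderiv one_ne_zero).integrable_of_hasCompactSupport (hzc.fderiv ℝ))] at sob
  set Y := ∫ x, ‖fderiv ℝ (fun x => (cutoff n x) ^ (s + 1) * (W x) ^ q) x‖ with hY
  have hY0 : 0 ≤ Y := integral_nonneg fun x => norm_nonneg _
  have hl : ∫⁻ x, ‖(cutoff n x) ^ (s + 1) * (W x) ^ q‖ₑ ^ χ =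
      ENNReal.ofReal (mJ n W ((s + 1) * χ) (q * χ)) := by
    rw [mJ, ofReal_integral_eq_lintegral_ofReal (h.J_int _ _ (by nlinarith))]
    · refine lintegral_congr fun x => ?_
      have p1 := Real.rpow_nonneg (hη0 x) (s + 1)
      have p2 := Real.rpow_nonneg (hW0 x).le q
      rw [Real.enorm_of_nonneg (mul_nonneg p1 p2), ENNReal.ofReal_rpow_of_nonneg
        (mul_nonneg p1 p2) hχ0.le, Real.mul_rpow p1 p2, ← Real.rpow_mul (hη0 x),
        ← Real.rpow_mul (hW0 x).le]
    · exact Filter.Eventually.of_forall fun x =>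
        mul_nonneg (Real.rpow_nonneg (hη0 x) _) (Real.rpow_nonneg (hW0 x).le _)
  rw [hl, ENNReal.ofReal_rpow_of_nonneg hY0 hχ0.le, ← hS, ← ENNReal.ofReal_coe_nnreal,
    ← ENNReal.ofReal_mul S.coe_nonneg, ENNReal.ofReal_le_ofReal_iff
      (mul_nonneg S.coe_nonneg (Real.rpow_nonneg hY0 _))] at sob
  have hg := hgrad a f W h s q hs hq
  rw [← hY] at hg
  have hSS : (S : ℝ) = ((S : ℝ) ^ χ⁻¹) ^ χ := by
    rw [← Real.rpow_mul S.coe_nonneg, inv_mul_cancel₀ hχ0.ne', Real.rpow_one]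
  have hSp : 0 ≤ (S : ℝ) ^ χ⁻¹ := Real.rpow_nonneg S.coe_nonneg _
  refine sob.trans ?_
  have hSY : (S : ℝ) * Y ^ χ = ((S : ℝ) ^ χ⁻¹ * Y) ^ χ := by
    rw [Real.mul_rpow hSp hY0, ← hSS]
  rw [hSY]
  refine Real.rpow_le_rpow (mul_nonneg hSp hY0) ?_ hχ0.le
  calc _ ≤ (S : ℝ) ^ χ⁻¹ * (C * ((s + 2) ^ 2 * q) * mJ n W s q) := by gcongr
    _ = ((S : ℝ) ^ χ⁻¹ * C) * ((s + 2) ^ 2 * q) * mJ n W s q := by ring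
    _ ≤ _ := by
      have hq0 : 0 ≤ q := by linarith
      exact mul_le_mul_of_nonneg_right (mul_le_mul_of_nonneg_right (le_max_right _ _)
        (by positivity)) hJ0
end LogSol

namespace LogSol
variable {n : ℕ} {ε : ℝ} {a : En n → Matrix (Fin n) (Fin n) ℝ} {f W : En n → ℝ}

lemma moser_iter (n : ℕ) (ε : ℝ) (χ : ℝ) (hχ : Real.HolderConjugate (n : ℝ) χ) :
    ∃ α : ℝ, ∀ a f W, LogSol n ε a f W →
    (volume (ball (0 : En n) 1) ≤ 2 * volume (ball (0 : En n) 1 ∩ {x | 1 / 2 ≤ f x})) →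
    ∀ k : ℕ, mJ n W ((n + 1) * χ ^ k - n) (2 * χ ^ k) ≤ Real.exp (α * χ ^ k) := by
  obtain ⟨C, hC, hstep⟩ := moser_step n ε χ hχ
  obtain ⟨C2, hC2, hl2⟩ := l2 n ε
  have hχ1 : 1 < χ := hχ.symm.lt
  have hχ0 : 0 < χ := by linarith
  have hχm : 0 < χ - 1 := by linarith
  have hnχ : (n : ℝ) * χ = n + χ := hχ.mul_eq_add
  have hn0 : (0:ℝ) ≤ n := Nat.cast_nonneg n
  set C' : ℝ := C * ((n + 3) ^ 2 * 2) with hC'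
  have hC'1 : 1 ≤ C' := by
    have : (1:ℝ) ≤ (n + 3) ^ 2 * 2 := by nlinarith
    nlinarith
  set b : ℝ := χ ^ 3 with hb
  have hb1 : 1 ≤ b := one_le_pow₀ hχ1.le
  have hlb : 0 ≤ Real.log b := Real.log_nonneg hb1
  have hlC : 0 ≤ Real.log C' := Real.log_nonneg hC'1
  set β : ℝ := χ * Real.log b / (χ - 1) with hβ
  have hβ0 : 0 ≤ β := by positivity
  set γ : ℝ := (χ * Real.log C' + β) / (χ - 1) with hγ
  have hγ0 : 0 ≤ γ := by positivity
  have eβ : (χ - 1) * β = χ * Real.log b := by rw [hβ]; field_simp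
  have eγ : (χ - 1) * γ = χ * Real.log C' + β := by rw [hγ]; field_simp
  set α : ℝ := γ + Real.log (max 1 C2) with hα
  refine ⟨α, fun a f W h hZ => ?_⟩
  have hη0 : ∀ x, 0 ≤ cutoff n x := fun x => (cutoff n).nonneg
  have hW0 : ∀ x, 0 < W x := fun x => by linarith [h.one_le x]
  have claim : ∀ k : ℕ, mJ n W ((n + 1) * χ ^ k - n) (2 * χ ^ k) ≤
      Real.exp (α * χ ^ k - β * k - γ) := by
    intro k
    induction k with
    | zero =>
      have h1 : mJ n W ((n + 1) * χ ^ 0 - n) (2 * χ ^ 0) ≤ ∫ x in ball (0 : En n) 1, W x ^ 2 := by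
        rw [← integral_indicator measurableSet_ball]
        have e1 : ((n:ℝ) + 1) * χ ^ 0 - n = 1 := by simp
        have e2 : (2:ℝ) * χ ^ 0 = 2 := by simp
        rw [e1, e2]
        refine integral_mono (h.J_int 1 2 one_pos) ((integrable_indicator_iff measurableSet_ball).2
          (intOn_ball (h.wcd.continuous.pow 2))) fun x => ?_
        simp only [Real.rpow_one, Real.rpow_two]
        by_cases hx : x ∈ ball (0 : En n) 1
        · rw [Set.indicator_of_mem hx]
          exact mul_le_of_le_one_left (sq_nonneg _) (cutoff n).le_one
        · rw [Set.indicator_of_notMem hx, (cutoff n).zero_of_le_dist (by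
            simpa [cutoff] using hx)]
          simp
      refine h1.trans ((hl2 a f W h hZ).trans ?_)
      have : α * χ ^ 0 - β * (0:ℕ) - γ = Real.log (max 1 C2) := by rw [hα]; simp
      rw [this, Real.exp_log (by positivity)]
      exact le_max_right _ _
    | succ k ih =>
      have hX : 1 ≤ χ ^ k := one_le_pow₀ hχ1.le
      have hs := hstep a f W h ((n + 1) * χ ^ k - n) (2 * χ ^ k) (by nlinarith) (by linarith)
      have e1 : ((n + 1) * χ ^ k - n + 1) * χ = (n + 1) * χ ^ (k + 1) - n := by
        rw [pow_succ]; linear_combination (-1 : ℝ) * hnχ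
      have e2 : 2 * χ ^ k * χ = 2 * χ ^ (k + 1) := by ring
      rw [e1, e2] at hs
      refine hs.trans ?_
      have hJ0 : 0 ≤ mJ n W ((n + 1) * χ ^ k - n) (2 * χ ^ k) := integral_nonneg fun x =>
        mul_nonneg (Real.rpow_nonneg (hη0 x) _) (Real.rpow_nonneg (hW0 x).le _)
      have e3 : C * (((n + 1) * χ ^ k - n + 2) ^ 2 * (2 * χ ^ k)) ≤ C' * b ^ k := by
        have : 0 ≤ (n + 1) * χ ^ k - n + 2 := by nlinarith
        calc _ ≤ C * (((n + 3) * χ ^ k) ^ 2 * (2 * χ ^ k)) := by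
              gcongr
              nlinarith
          _ = _ := by rw [hC', hb]; ring
      have e4 : C' * b ^ k = Real.exp (Real.log C' + k * Real.log b) := by
        rw [Real.exp_add, Real.exp_log (by linarith), Real.exp_nat_mul, Real.exp_log (by linarith)]
      have e5 : 0 ≤ C * (((n + 1) * χ ^ k - n + 2) ^ 2 * (2 * χ ^ k)) := by positivity
      calc _ ≤ (Real.exp (Real.log C' + k * Real.log b) * Real.exp (α * χ ^ k - β * k - γ)) ^ χ := by
            refine Real.rpow_le_rpow (mul_nonneg e5 hJ0) ?_ hχ0.le
            rw [← e4]
            exact mul_le_mul e3 ih hJ0 (by positivity)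
        _ = Real.exp ((Real.log C' + k * Real.log b + (α * χ ^ k - β * k - γ)) * χ) := by
            rw [← Real.exp_add, ← Real.exp_mul]
        _ ≤ _ := by
            apply Real.exp_le_exp.2
            apply le_of_eq
            push_cast
            rw [pow_succ]
            linear_combination (-(k:ℝ)) * eβ - eγ
  intro k
  refine (claim k).trans (Real.exp_le_exp.2 ?_)
  have : 0 ≤ β * k := by positivity
  linarith

lemma sup_bound (n : ℕ) (hn : 2 ≤ n) (ε : ℝ) : ∃ A : ℝ, ∀ a f W, LogSol n ε a f W →
    (volume (ball (0 : En n) 1) ≤ 2 * volume (ball (0 : En n) 1 ∩ {x | 1 / 2 ≤ f x})) →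
    ∀ x ∈ ball (0 : En n) (1 / 2), W x ≤ A := by
  set χ : ℝ := Real.conjExponent n
  have hχ : Real.HolderConjugate (n : ℝ) χ :=
    Real.HolderConjugate.conjExponent (by exact_mod_cast hn)
  have hχ1 : 1 < χ := hχ.symm.lt
  have hn0 : (0:ℝ) ≤ n := Nat.cast_nonneg n
  obtain ⟨α, hα⟩ := moser_iter n ε χ hχ
  refine ⟨Real.exp (α / 2), fun a f W h hZ x hx => ?_⟩
  by_contra hlt
  push Not at hlt
  set A := Real.exp (α / 2) with hA
  have hA0 : 0 < A := Real.exp_pos _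
  set L := (A + W x) / 2 with hL
  have hL1 : A < L := by linarith
  have hL2 : L < W x := by linarith
  have hL0 : 0 < L := by linarith
  set U : Set (En n) := ball (0 : En n) (1 / 2) ∩ {y | L < W y} with hU
  have hUo : IsOpen U := isOpen_ball.inter (isOpen_lt continuous_const h.wcd.continuous)
  have hUfin : volume U ≠ ⊤ := ne_top_of_le_ne_top measure_ball_lt_top.ne (measure_mono Set.inter_subset_left)
  have hUpos : 0 < volume.real U :=
    ENNReal.toReal_pos (hUo.measure_pos volume ⟨x, hx, hL2⟩).ne' hUfin
  have hη0 : ∀ x, 0 ≤ cutoff n x := fun x => (cutoff n).nonneg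
  have hW0 : ∀ x, 0 < W x := fun x => by linarith [h.one_le x]
  have hr : 0 < Real.log (L / A) := Real.log_pos (by rwa [one_lt_div hA0])
  obtain ⟨k, hk⟩ := pow_unbounded_of_one_lt (1 / (volume.real U * (2 * Real.log (L / A)))) hχ1
  have hX : 1 ≤ χ ^ k := one_le_pow₀ hχ1.le
  have h1 := hα a f W h hZ k
  have h2 : volume.real U * L ^ (2 * χ ^ k) ≤ mJ n W ((n + 1) * χ ^ k - n) (2 * χ ^ k) := by
    have : volume.real U * L ^ (2 * χ ^ k) = ∫ y, U.indicator (fun _ => L ^ (2 * χ ^ k)) y := by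
      rw [integral_indicator hUo.measurableSet, setIntegral_const, smul_eq_mul]
    rw [this]
    refine integral_mono ((integrable_indicator_iff hUo.measurableSet).2
      (integrableOn_const hUfin)) (h.J_int _ _ (by nlinarith)) fun y => ?_
    by_cases hy : y ∈ U
    · rw [Set.indicator_of_mem hy]
      have : cutoff n y = 1 := (cutoff n).one_of_mem_closedBall (ball_subset_closedBall hy.1)
      simp only [this, Real.one_rpow, one_mul]
      exact Real.rpow_le_rpow hL0.le (le_of_lt hy.2) (by linarith)
    · rw [Set.indicator_of_notMem hy]
      exact mul_nonneg (Real.rpow_nonneg (hη0 y) _) (Real.rpow_nonneg (hW0 y).le _)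
  have h3 : Real.exp (α * χ ^ k) = A ^ (2 * χ ^ k) := by
    rw [hA, ← Real.exp_mul]; congr 1; ring
  rw [h3] at h1
  have h4 : volume.real U * (L / A) ^ (2 * χ ^ k) ≤ 1 := by
    rw [Real.div_rpow hL0.le hA0.le, ← mul_div_assoc, div_le_one (Real.rpow_pos_of_pos hA0 _)]
    exact h2.trans h1
  have h5 : Real.log (L / A) * (2 * χ ^ k) ≤ (L / A) ^ (2 * χ ^ k) := by
    rw [Real.rpow_def_of_pos (by positivity)]
    have := Real.add_one_le_exp (Real.log (L / A) * (2 * χ ^ k))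
    linarith
  rw [div_lt_iff₀ (by positivity)] at hk
  have h6 := mul_le_mul_of_nonneg_left h5 hUpos.le
  nlinarith

end LogSol

/-- The unit scale lower bound. -/
lemma unit_lower (n : ℕ) (hn : 2 ≤ n) (ε : ℝ) : ∃ c : ℝ, 0 < c ∧ ∀ a f, Ell n ε a →
    ContDiff ℝ 1 f → Weak n a f → (∀ x, 0 < f x) → (∀ x, f x ≤ 2) →
    (volume (ball (0 : En n) 1) ≤ 2 * volume (ball (0 : En n) 1 ∩ {x | 1 / 2 ≤ f x})) →
    ∀ x ∈ ball (0 : En n) (1 / 2), c ≤ f x := by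
  obtain ⟨A, hA⟩ := LogSol.sup_bound n hn ε
  refine ⟨Real.exp (1 + Real.log 2 - A), Real.exp_pos _, fun a f h1 h2 h3 h4 h5 hZ x hx => ?_⟩
  have := hA a f _ ⟨h1, h2, h3, h4, h5, rfl⟩ hZ x hx
  rw [← Real.le_log_iff_exp_le (h4 x)]
  linarith

lemma fderiv_dil {n : ℕ} {g : En n → ℝ} (hg : ContDiff ℝ 1 g) (R : ℝ) (x : En n) :
    fderiv ℝ (fun x => g (R • x)) x = R • fderiv ℝ g (R • x) := by
  have h1 : HasFDerivAt (fun x : En n => R • x) (R • ContinuousLinearMap.id ℝ (En n)) x :=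
    (hasFDerivAt_id x).const_smul R
  have h2 := (hg.differentiable one_ne_zero (R • x)).hasFDerivAt.comp x h1
  refine h2.fderiv.trans ?_
  ext v
  simp

lemma Ell.dil {n : ℕ} {ε : ℝ} {a : En n → Matrix (Fin n) (Fin n) ℝ} (h : Ell n ε a) (R : ℝ) :
    Ell n ε (fun x => a (R • x)) :=
  ⟨h.eps, fun i j => (h.meas i j).comp (measurable_const_smul R), fun x => h.ell (R • x)⟩

lemma Weak.dil {n : ℕ} {a : En n → Matrix (Fin n) (Fin n) ℝ} {f : En n → ℝ} (h : Weak n a f)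
    (hf : ContDiff ℝ 1 f) (R : ℝ) (hR : 0 < R) :
    Weak n (fun x => a (R • x)) (fun x => f (R • x)) := by
  intro φ hφ hc
  have hφ1 : ContDiff ℝ 1 φ := hφ.of_le (by exact_mod_cast le_top)
  have hψ : ContDiff ℝ (⊤ : ℕ∞) fun x => φ (R⁻¹ • x) := hφ.comp (contDiff_const_smul R⁻¹)
  have hψ1 : ContDiff ℝ 1 fun x => φ (R⁻¹ • x) := hφ1.comp (contDiff_const_smul R⁻¹)
  have hψc : HasCompactSupport fun x => φ (R⁻¹ • x) :=
    hc.comp_homeomorph (Homeomorph.smulOfNeZero R⁻¹ (inv_ne_zero hR.ne'))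
  have key := h _ hψ hψc
  have e : ∀ x, bf (a (R • x)) (fderiv ℝ (fun x => f (R • x)) x) (fderiv ℝ φ x) =
      (R * R) * (fun y => bf (a y) (fderiv ℝ f y) (fderiv ℝ (fun x => φ (R⁻¹ • x)) y)) (R • x) := by
    intro x
    simp only
    rw [fderiv_dil hf, fderiv_dil hφ1, smul_smul, inv_mul_cancel₀ hR.ne', one_smul, bf_smul_left,
      bf_smul_right]
    field_simp
  simp only [e]
  rw [integral_const_mul, Measure.integral_comp_smul volume
    (fun y => bf (a y) (fderiv ℝ f y) (fderiv ℝ (fun x => φ (R⁻¹ • x)) y)), key]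
  simp

lemma Weak.affine {n : ℕ} {a : En n → Matrix (Fin n) (Fin n) ℝ} {f : En n → ℝ} (h : Weak n a f)
    (hf : ContDiff ℝ 1 f) (c d : ℝ) : Weak n a (fun x => c * f x + d) := by
  intro φ hφ hc
  have e : ∀ x, fderiv ℝ (fun x => c * f x + d) x = c • fderiv ℝ f x := fun x =>
    (((hf.differentiable one_ne_zero x).hasFDerivAt.const_mul c).add_const d).fderiv
  simp only [e, bf_smul_left]
  rw [integral_const_mul, h φ hφ hc, mul_zero]

lemma liouville_ge_two (n : ℕ) (hn : 2 ≤ n) (ε : ℝ) (a : En n → Matrix (Fin n) (Fin n) ℝ)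
    (ha : Ell n ε a) (f : En n → ℝ) (hf : ContDiff ℝ 1 f) (hw : Weak n a f)
    (hbdd : ∃ C : ℝ, ∀ x, |f x| ≤ C) : ∀ x y, f x = f y := by
  obtain ⟨C, hC⟩ := hbdd
  obtain ⟨c₀, hc₀, hlow⟩ := unit_lower n hn ε
  have hba : BddAbove (Set.range f) := ⟨C, by rintro _ ⟨x, rfl⟩; exact (abs_le.1 (hC x)).2⟩
  have hbb : BddBelow (Set.range f) := ⟨-C, by rintro _ ⟨x, rfl⟩; exact (abs_le.1 (hC x)).1⟩
  have hne : (Set.range f).Nonempty := Set.range_nonempty f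
  set m := sInf (Set.range f)
  set M := sSup (Set.range f)
  have hm : ∀ x, m ≤ f x := fun x => csInf_le hbb ⟨x, rfl⟩
  have hM : ∀ x, f x ≤ M := fun x => le_csSup hba ⟨x, rfl⟩
  by_contra hcon
  push Not at hcon
  obtain ⟨x, y, hxy⟩ := hcon
  have hD : 0 < M - m := by
    rcases lt_or_gt_of_ne hxy with h | h
    · linarith [hm x, hM y]
    · linarith [hm y, hM x]
  set D := M - m with hDdef
  set c := min c₀ 1 with hcdef
  have hc0 : 0 < c := lt_min hc₀ one_pos
  have hc1 : c ≤ 1 := min_le_right _ _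
  have hcc : c ≤ c₀ := min_le_left _ _
  have hDc : 0 < D * (c / 4) := by positivity
  obtain ⟨_, ⟨x0, rfl⟩, hx0⟩ := exists_lt_of_csInf_lt hne (show m < m + D * (c / 4) by linarith)
  obtain ⟨_, ⟨x1, rfl⟩, hx1⟩ := exists_lt_of_lt_csSup hne (show M - D * (c / 4) < M by linarith)
  set R : ℝ := 2 * (‖x0‖ + ‖x1‖) + 1 with hRdef
  have hR : 0 < R := by positivity
  have hmem : ∀ z : En n, ‖z‖ ≤ ‖x0‖ + ‖x1‖ → R⁻¹ • z ∈ ball (0 : En n) (1 / 2) := by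
    intro z hz
    rw [mem_ball, dist_zero_right, norm_smul, norm_inv, Real.norm_of_nonneg hR.le,
      inv_mul_eq_div, div_lt_iff₀ hR]
    linarith
  set F : En n → ℝ := fun x => D⁻¹ * f x + (c / 4 - D⁻¹ * m) with hF
  set G : En n → ℝ := fun x => (-D⁻¹) * f x + (c / 4 + D⁻¹ * M) with hG
  have eF : ∀ x, F x = (f x - m) / D + c / 4 := fun x => by simp only [hF]; field_simp; ring
  have eG : ∀ x, G x = (M - f x) / D + c / 4 := fun x => by simp only [hG]; field_simp; ring
  have b1 : ∀ x, 0 ≤ (f x - m) / D := fun x => div_nonneg (by linarith [hm x]) hD.le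
  have b2 : ∀ x, 0 ≤ (M - f x) / D := fun x => div_nonneg (by linarith [hM x]) hD.le
  have b3 : ∀ x, (f x - m) / D + (M - f x) / D = 1 := fun x => by
    rw [← add_div]; rw [show f x - m + (M - f x) = D by rw [hDdef]; ring]; exact div_self hD.ne'
  have hFc : ContDiff ℝ 1 F := (contDiff_const.mul hf).add contDiff_const
  have hGc : ContDiff ℝ 1 G := (contDiff_const.mul hf).add contDiff_const
  have hFw : Weak n a F := hw.affine hf _ _
  have hGw : Weak n a G := hw.affine hf _ _
  have hsum : volume (ball (0 : En n) 1) ≤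
      volume (ball (0 : En n) 1 ∩ {x | 1 / 2 ≤ F (R • x)}) +
      volume (ball (0 : En n) 1 ∩ {x | 1 / 2 ≤ G (R • x)}) := by
    refine le_trans (measure_mono ?_) (measure_union_le _ _)
    intro z hz
    rw [← Set.inter_union_distrib_left]
    refine ⟨hz, ?_⟩
    by_contra hno
    simp only [Set.mem_union, Set.mem_setOf_eq, not_or, not_le] at hno
    have := b3 (R • z)
    linarith [eF (R • z), eG (R • z), hno.1, hno.2]
  have main : ∀ H : En n → ℝ, ContDiff ℝ 1 H → Weak n a H → (∀ x, 0 < H x) → (∀ x, H x ≤ 2) →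
      (volume (ball (0 : En n) 1) ≤ 2 * volume (ball (0 : En n) 1 ∩ {x | 1 / 2 ≤ H (R • x)})) →
      ∀ z, ‖z‖ ≤ ‖x0‖ + ‖x1‖ → c ≤ H z := by
    intro H h1 h2 h3 h4 h5 z hz
    have := hlow (fun x => a (R • x)) (fun x => H (R • x)) (ha.dil R)
      (h1.comp (contDiff_const_smul R)) (h2.dil h1 R hR) (fun x => h3 _) (fun x => h4 _) h5
      (R⁻¹ • z) (hmem z hz)
    simp only [smul_smul, mul_inv_cancel₀ hR.ne', one_smul] at this
    linarith
  rcases le_total (volume (ball (0 : En n) 1 ∩ {x | 1 / 2 ≤ F (R • x)}))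
    (volume (ball (0 : En n) 1 ∩ {x | 1 / 2 ≤ G (R • x)})) with hle | hle
  · have := main G hGc hGw (fun x => by rw [eG]; linarith [b2 x])
      (fun x => by rw [eG]; linarith [b1 x, b3 x])
      (hsum.trans (by rw [two_mul]; gcongr)) x1 (by linarith [norm_nonneg x0])
    rw [eG] at this
    have h2 : (M - f x1) / D < c / 4 := by rw [div_lt_iff₀ hD]; linarith
    linarith
  · have := main F hFc hFw (fun x => by rw [eF]; linarith [b1 x])
      (fun x => by rw [eF]; linarith [b2 x, b3 x])
      (hsum.trans (by rw [two_mul]; gcongr)) x0 (by linarith [norm_nonneg x1])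
    rw [eF] at this
    have h2 : (f x0 - m) / D < c / 4 := by rw [div_lt_iff₀ hD]; linarith
    linarith

lemma liouville_one (ε : ℝ) (a : En 1 → Matrix (Fin 1) (Fin 1) ℝ)
    (ha : Ell 1 ε a) (f : En 1 → ℝ) (hf : ContDiff ℝ 1 f) (hw : Weak 1 a f)
    (hbdd : ∃ C : ℝ, ∀ x, |f x| ≤ C) : ∀ x y, f x = f y := by
  obtain ⟨C, hC⟩ := hbdd
  have hC0 : 0 ≤ C := (abs_nonneg _).trans (hC 0)
  set d := (C + 1)⁻¹ with hd
  have hd0 : 0 < d := by positivity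
  set F : En 1 → ℝ := fun x => d * f x + 1 with hF
  have hb : ∀ x, |d * f x| < 1 := fun x => by
    rw [abs_mul, abs_of_pos hd0, hd, inv_mul_lt_iff₀ (by positivity)]
    linarith [hC x]
  have hF0 : ∀ x, 0 < F x := fun x => by have := (abs_lt.1 (hb x)).1; simp only [hF]; linarith
  have hF2 : ∀ x, F x ≤ 2 := fun x => by have := (abs_lt.1 (hb x)).2; simp only [hF]; linarith
  have hFc : ContDiff ℝ 1 F := (contDiff_const.mul hf).add contDiff_const
  have hFw : Weak 1 a F := hw.affine hf _ _
  set W : En 1 → ℝ := fun x => (1 + Real.log 2) - Real.log (F x) with hWdef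
  have hL : LogSol 1 ε a F W := ⟨ha, hFc, hFw, hF0, hF2, rfl⟩
  have hWc := hL.wcd
  have hWd : Continuous (fderiv ℝ W) := hWc.continuous_fderiv one_ne_zero
  obtain ⟨K, hK0, hK⟩ := LogSol.energy 1 ε
  have hgc : Continuous fun x => ‖fderiv ℝ W x‖ ^ 2 := by fun_prop
  have hIntg : ∀ r : ℝ, IntegrableOn (fun x => ‖fderiv ℝ W x‖ ^ 2) (ball (0 : En 1) r) := fun r =>
    (hgc.continuousOn.integrableOn_compact (isCompact_closedBall 0 r)).mono_set ball_subset_closedBall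
  have hen : ∀ R : ℝ, 0 < R → R * ∫ x in ball (0 : En 1) R, ‖fderiv ℝ W x‖ ^ 2 ≤ K := by
    intro R hR
    have h1 := hK (fun x => a (R • x)) (fun x => F (R • x)) (fun x => W (R • x))
      ⟨ha.dil R, hFc.comp (contDiff_const_smul R), hFw.dil hFc R hR, fun x => hF0 _,
        fun x => hF2 _, rfl⟩
    have e : ∀ x, ‖fderiv ℝ (fun x => W (R • x)) x‖ ^ 2 =
        R ^ 2 * (fun y => ‖fderiv ℝ W y‖ ^ 2) (R • x) := fun x => by
      rw [fderiv_dil hWc, norm_smul, mul_pow, Real.norm_of_nonneg hR.le]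
    simp only [e] at h1
    rw [integral_const_mul, Measure.setIntegral_comp_smul_of_pos volume
      (fun y => ‖fderiv ℝ W y‖ ^ 2) _ hR, smul_unitBall hR.ne'] at h1
    simp only [finrank_euclideanSpace, Fintype.card_fin, pow_one, smul_eq_mul,
      Real.norm_of_nonneg hR.le] at h1
    refine le_trans (le_of_eq ?_) h1
    field_simp
  have hzero : ∀ x, fderiv ℝ W x = 0 := by
    intro x
    set r := ‖x‖ + 1 with hr
    have hr0 : 0 < r := by positivity
    set I := ∫ x in ball (0 : En 1) r, ‖fderiv ℝ W x‖ ^ 2 with hI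
    have hI0 : 0 ≤ I := integral_nonneg fun x => by positivity
    have hI1 : I = 0 := by
      by_contra hne
      have hpos : 0 < I := lt_of_le_of_ne hI0 (Ne.symm hne)
      set R := max r ((K + 1) / I) with hRdef
      have hR : 0 < R := lt_of_lt_of_le hr0 (le_max_left _ _)
      have h1 := hen R hR
      have h2 : I ≤ ∫ x in ball (0 : En 1) R, ‖fderiv ℝ W x‖ ^ 2 :=
        setIntegral_mono_set (hIntg R) (Filter.Eventually.of_forall fun x => by positivity)
          (ball_subset_ball (le_max_left _ _)).eventuallyLE
      have h3 : (K + 1) / I ≤ R := le_max_right _ _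
      rw [div_le_iff₀ hpos] at h3
      have h4 := mul_le_mul_of_nonneg_left h2 hR.le
      linarith
    have h5 := (setIntegral_eq_zero_iff_of_nonneg_ae
      (Filter.Eventually.of_forall fun x => by positivity) (hIntg r)).1 hI1
    have h6 := Measure.eqOn_open_of_ae_eq h5 isOpen_ball hgc.continuousOn continuousOn_const
    have h7 := h6 (show x ∈ ball (0 : En 1) r by simp [hr])
    simpa using h7
  intro x y
  have h1 := is_const_of_fderiv_eq_zero (hWc.differentiable one_ne_zero) hzero x y
  have h2 : Real.log (F x) = Real.log (F y) := by simp only [hWdef] at h1; linarith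
  have h3 : F x = F y := Real.log_injOn_pos (hF0 x) (hF0 y) h2
  simp only [hF] at h3
  have : d * f x = d * f y := by linarith
  exact mul_left_cancel₀ hd0.ne' this

/-- Liouville theorem for uniformly elliptic divergence-form operators: a bounded `C¹`
global weak solution of `∂_j(aⁱʲ(x) ∂_i f) = 0` on `ℝⁿ`, with measurable coefficients
satisfying `ε Iₙ ≤ a(x) ≤ ε⁻¹ Iₙ`, is constant. -/
theorem liouville_divergence_form
    (n : ℕ) (hn : 1 ≤ n) (ε : ℝ) (hε : 0 < ε)
    (a : En n → Matrix (Fin n) (Fin n) ℝ)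
    (hmeas : ∀ i j, Measurable fun x => a x i j)
    (hell : ∀ x, (a x - ε • (1 : Matrix (Fin n) (Fin n) ℝ)).PosSemidef ∧
      ((ε⁻¹ : ℝ) • (1 : Matrix (Fin n) (Fin n) ℝ) - a x).PosSemidef)
    (f : En n → ℝ) (hf : ContDiff ℝ 1 f)
    (hbdd : ∃ C : ℝ, ∀ x, |f x| ≤ C)
    (hsol : ∀ φ : En n → ℝ, ContDiff ℝ (⊤ : ℕ∞) φ → HasCompactSupport φ →
      ∫ x, (a x *ᵥ gradv n f x) ⬝ᵥ gradv n φ x = 0) :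
    ∀ x y, f x = f y := by
  have ha : Ell n ε a := ⟨hε, hmeas, hell⟩
  have hw : Weak n a f := hsol
  rcases hn.eq_or_lt with h1 | h2
  · subst h1
    exact liouville_one ε a ha f hf hw hbdd
  · exact liouville_ge_two n h2 ε a ha f hf hw hbdd
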